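/- Let S⁰ be an adequate semigroup with semilattice of idempotents E⁰, L a left adequate semigroup and R a right adequate semigroup such that S⁰ is a quasi-ideal adequate transversal of both L and R, let ∗ : R × L → S⁰ satisfy conditions (1) and (2), and let T = {(x,a) ∈ L × R : x̄ = ā} with multiplication (x,a)(y,b) = (e_x(a∗y), (a∗y)f_b). Then for every (x,a) ∈ T, the pairs (e_x, e_{x̄}) and (f_{ā}, f_a) are idempotents of T with (x,a) R* (e_x, e_{x̄}) and (x,a) L* (f_{ā}, f_a) in T; consequently T is an abundant semigroup. -/

import Mathlib

/-!
Common framework: "relative" semigroup-theoretic notions.  All notions are taken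
relative to a carrier set `U` inside an ambient type, together with an explicit
binary operation `mul` (only the values of `mul` on `U` are relevant).  For an
honest semigroup `S` one takes `U = Set.univ` and `mul = mulOf S`.

* `RStarOn mul U a b` : the relation `a ℛ* b` computed in `U` with an identity
  adjoined (the two clauses correspond to multipliers from `U` and to the
  adjoined identity).
* `LStarOn`, `GreenLOn`, `GreenROn` : dual / Green's relations.
* `AbundantOn`, `AdequateOn`, `LeftAdequateOn`, `RightAdequateOn`.
* `AdequateTransversalOn mul U S0` : `S0` is an adequate `*`-subsemigroup of `U`
  which is an adequate transversal, with the data `bar x = x̄`, `e x = e_x`,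
  `f x = f_x`, and `plus s = s⁺`, `star s = s⋆` for `s ∈ S0`.
* `InverseTransversalOn mul U S0` : `S0` is an inverse transversal of the
  regular semigroup `U`, with `o x = x⁰` the unique inverse of `x` in `S0`.
-/

namespace Paper

universe u

variable {α : Type*} {β : Type*} {γ : Type*}

def mulOf (α : Type*) [Mul α] : α → α → α := fun a b => a * b

/-- `x` is an idempotent for the operation `mul`. -/
def Idem (mul : α → α → α) (x : α) : Prop := mul x x = x

/-- The relation `ℛ*` on `U` (with an identity adjoined to `U`). -/
def RStarOn (mul : α → α → α) (U : Set α) (a b : α) : Prop :=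
  (∀ x ∈ U, ∀ y ∈ U, (mul x a = mul y a ↔ mul x b = mul y b)) ∧
  (∀ x ∈ U, (mul x a = a ↔ mul x b = b))

/-- The relation `ℒ*` on `U` (with an identity adjoined to `U`). -/
def LStarOn (mul : α → α → α) (U : Set α) (a b : α) : Prop :=
  (∀ x ∈ U, ∀ y ∈ U, (mul a x = mul a y ↔ mul b x = mul b y)) ∧
  (∀ x ∈ U, (mul a x = a ↔ mul b x = b))

/-- Green's relation `ℒ` on `U`: `U¹ a = U¹ b`. -/
def GreenLOn (mul : α → α → α) (U : Set α) (a b : α) : Prop :=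
  (a = b ∨ ∃ u ∈ U, mul u b = a) ∧ (b = a ∨ ∃ v ∈ U, mul v a = b)

/-- Green's relation `ℛ` on `U`: `a U¹ = b U¹`. -/
def GreenROn (mul : α → α → α) (U : Set α) (a b : α) : Prop :=
  (a = b ∨ ∃ u ∈ U, mul b u = a) ∧ (b = a ∨ ∃ v ∈ U, mul a v = b)

/-- `U` is closed under `mul`. -/
def ClosedOn (mul : α → α → α) (U : Set α) : Prop :=
  ∀ a ∈ U, ∀ b ∈ U, mul a b ∈ U

/-- `U` with the operation `mul` is a semigroup. -/
def SemigroupOn (mul : α → α → α) (U : Set α) : Prop :=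
  ClosedOn mul U ∧ ∀ a ∈ U, ∀ b ∈ U, ∀ c ∈ U, mul (mul a b) c = mul a (mul b c)

/-- Every `ℛ*`-class and every `ℒ*`-class of `U` contains an idempotent. -/
def AbundantOn (mul : α → α → α) (U : Set α) : Prop :=
  ∀ a ∈ U, (∃ e ∈ U, Idem mul e ∧ RStarOn mul U a e) ∧
           (∃ f ∈ U, Idem mul f ∧ LStarOn mul U a f)

/-- Abundant with commuting idempotents. -/
def AdequateOn (mul : α → α → α) (U : Set α) : Prop :=
  AbundantOn mul U ∧
    ∀ u ∈ U, ∀ v ∈ U, Idem mul u → Idem mul v → mul u v = mul v u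

/-- Abundant, and every `ℛ*`-class contains a unique idempotent. -/
def LeftAdequateOn (mul : α → α → α) (U : Set α) : Prop :=
  AbundantOn mul U ∧
    ∀ u ∈ U, ∀ v ∈ U, Idem mul u → Idem mul v → RStarOn mul U u v → u = v

/-- Abundant, and every `ℒ*`-class contains a unique idempotent. -/
def RightAdequateOn (mul : α → α → α) (U : Set α) : Prop :=
  AbundantOn mul U ∧
    ∀ u ∈ U, ∀ v ∈ U, Idem mul u → Idem mul v → LStarOn mul U u v → u = v

/-- `S0` is a quasi-ideal of `U` : `S0 U S0 ⊆ S0`. -/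
def QuasiIdealOn (mul : α → α → α) (U S0 : Set α) : Prop :=
  ∀ s ∈ S0, ∀ x ∈ U, ∀ t ∈ S0, mul (mul s x) t ∈ S0

/-- Every element of `U` has an inverse in `U`. -/
def RegularOn (mul : α → α → α) (U : Set α) : Prop :=
  ∀ x ∈ U, ∃ u ∈ U, mul (mul x u) x = x ∧ mul (mul u x) u = u

/-- Regular with commuting idempotents, i.e. an inverse semigroup. -/
def InverseSgpOn (mul : α → α → α) (U : Set α) : Prop :=
  RegularOn mul U ∧
    ∀ u ∈ U, ∀ v ∈ U, Idem mul u → Idem mul v → mul u v = mul v u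

/-- Regular, and every Green `ℛ`-class contains a unique idempotent. -/
def LeftInverseSgpOn (mul : α → α → α) (U : Set α) : Prop :=
  RegularOn mul U ∧
    ∀ u ∈ U, ∀ v ∈ U, Idem mul u → Idem mul v → GreenROn mul U u v → u = v

/-- Regular, and every Green `ℒ`-class contains a unique idempotent. -/
def RightInverseSgpOn (mul : α → α → α) (U : Set α) : Prop :=
  RegularOn mul U ∧
    ∀ u ∈ U, ∀ v ∈ U, Idem mul u → Idem mul v → GreenLOn mul U u v → u = v

/-- An isomorphism from `(A, mulA)` onto `(B, mulB)`. -/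
def IsoOn (mulA : α → α → α) (mulB : β → β → β) (A : Set α) (B : Set β) : Prop :=
  ∃ θ : α → β, Set.BijOn θ A B ∧ ∀ a ∈ A, ∀ b ∈ A, θ (mulA a b) = mulB (θ a) (θ b)

/-- `S0` is an adequate transversal of the abundant semigroup `U`.  `S0` is an
adequate `*`-subsemigroup of `U` (witnessed by `plus`/`star`, the canonical
idempotents `a⁺ ℛ* a`, `a⋆ ℒ* a` of elements of `S0`, the `ℛ*`/`ℒ*` relations
being those of the big semigroup `U`, which gives the `*`-subsemigroup property),
and every `x ∈ U` factors uniquely as `x = e_x x̄ f_x` with `x̄ ∈ S0`,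
`e_x, f_x` idempotents of `U`, `e_x ℒ x̄⁺` and `f_x ℛ x̄⋆`. -/
structure AdequateTransversalOn (mul : α → α → α) (U S0 : Set α) where
  sub : S0 ⊆ U
  mul_mem : ∀ a ∈ S0, ∀ b ∈ S0, mul a b ∈ S0
  bar : α → α
  e : α → α
  f : α → α
  plus : α → α
  star : α → α
  plus_mem : ∀ a ∈ S0, plus a ∈ S0
  plus_idem : ∀ a ∈ S0, Idem mul (plus a)
  plus_rstar : ∀ a ∈ S0, RStarOn mul U a (plus a)
  star_mem : ∀ a ∈ S0, star a ∈ S0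
  star_idem : ∀ a ∈ S0, Idem mul (star a)
  star_lstar : ∀ a ∈ S0, LStarOn mul U a (star a)
  idem_comm : ∀ u ∈ S0, ∀ v ∈ S0, Idem mul u → Idem mul v → mul u v = mul v u
  bar_mem : ∀ x ∈ U, bar x ∈ S0
  e_mem : ∀ x ∈ U, e x ∈ U
  f_mem : ∀ x ∈ U, f x ∈ U
  e_idem : ∀ x ∈ U, Idem mul (e x)
  f_idem : ∀ x ∈ U, Idem mul (f x)
  decomp : ∀ x ∈ U, x = mul (mul (e x) (bar x)) (f x)
  e_greenL : ∀ x ∈ U, GreenLOn mul U (e x) (plus (bar x))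
  f_greenR : ∀ x ∈ U, GreenROn mul U (f x) (star (bar x))
  unique : ∀ x ∈ U, ∀ s ∈ S0, ∀ e' ∈ U, ∀ f' ∈ U, Idem mul e' → Idem mul f' →
      x = mul (mul e' s) f' → GreenLOn mul U e' (plus s) → GreenROn mul U f' (star s) →
      s = bar x ∧ e' = e x ∧ f' = f x

namespace AdequateTransversalOn

variable {mul : α → α → α} {U S0 : Set α}

/-- `R = {x ∈ U : e_x = e_{x̄}}`. -/
def Rset (T : AdequateTransversalOn mul U S0) : Set α :=
  {x | x ∈ U ∧ T.e x = T.e (T.bar x)}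

/-- `L = {x ∈ U : f_x = f_{x̄}}`. -/
def Lset (T : AdequateTransversalOn mul U S0) : Set α :=
  {x | x ∈ U ∧ T.f x = T.f (T.bar x)}

/-- `I = {e_x : x ∈ U}`. -/
def Iset (T : AdequateTransversalOn mul U S0) : Set α :=
  {y | ∃ x ∈ U, T.e x = y}

/-- `Λ = {f_x : x ∈ U}`. -/
def LamSet (T : AdequateTransversalOn mul U S0) : Set α :=
  {y | ∃ x ∈ U, T.f x = y}

/-- The transversal is multiplicative: `Λ I ⊆ E⁰`. -/
def IsMultiplicative (T : AdequateTransversalOn mul U S0) : Prop :=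
  ∀ l ∈ T.LamSet, ∀ i ∈ T.Iset, mul l i ∈ S0 ∧ Idem mul (mul l i)

end AdequateTransversalOn

/-- The spined product set `T = L |×| R ⊆ S × S` attached to an adequate
transversal of `S` (ambient carrier `U`). -/
def spSet {mul : α → α → α} {U S0 : Set α}
    (T : AdequateTransversalOn mul U S0) : Set (α × α) :=
  {p | p.1 ∈ T.Lset ∧ p.2 ∈ T.Rset ∧ T.bar p.1 = T.bar p.2}

/-- The multiplication `(x,a)(y,b) = (e_x(ay), (ay) f_b)` on the spined product. -/
def spMul {mul : α → α → α} {U S0 : Set α}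
    (T : AdequateTransversalOn mul U S0) : α × α → α × α → α × α :=
  fun p q => (mul (T.e p.1) (mul p.2 q.1), mul (mul p.2 q.1) (T.f q.2))

/-- The map `φ : S → T`, `x ↦ (e_x x̄, x̄ f_x)`. -/
def phiMap {mul : α → α → α} {U S0 : Set α}
    (T : AdequateTransversalOn mul U S0) : α → α × α :=
  fun x => (mul (T.e x) (T.bar x), mul (T.bar x) (T.f x))

/-- `T⁰ = {(s,s) : s ∈ S0}`. -/
def diagSet (S0 : Set α) : Set (α × α) := {p | ∃ s ∈ S0, p = (s, s)}

/-- Abstract spined product `L |×| R` over a common transversal `S⁰` (a type `γ`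
embedded into `L` and `R` by `jL`, `jR`). -/
def absTset {mulL : α → α → α} {mulR : β → β → β} {jL : γ → α} {jR : γ → β}
    (TL : AdequateTransversalOn mulL Set.univ (Set.range jL))
    (TR : AdequateTransversalOn mulR Set.univ (Set.range jR)) : Set (α × β) :=
  {p | ∃ s : γ, jL s = TL.bar p.1 ∧ jR s = TR.bar p.2}

/-- The multiplication `(x,a)(y,b) = (e_x(a∗y), (a∗y) f_b)`. -/
def absMul {mulL : α → α → α} {mulR : β → β → β} {jL : γ → α} {jR : γ → β}
    (TL : AdequateTransversalOn mulL Set.univ (Set.range jL))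
    (TR : AdequateTransversalOn mulR Set.univ (Set.range jR))
    (st : β → α → γ) : α × β → α × β → α × β :=
  fun p q => (mulL (TL.e p.1) (jL (st p.2 q.1)), mulR (jR (st p.2 q.1)) (TR.f q.2))

/-- `T⁰ = {(s,s) : s ∈ S⁰}` inside `L × R`, where `s` is viewed in `L` and in `R`. -/
def absT0 (jL : γ → α) (jR : γ → β) : Set (α × β) :=
  {p | ∃ s : γ, p = (jL s, jR s)}

/-- `S0` is an inverse transversal of the regular semigroup `U`: an inverse
subsemigroup meeting the set of inverses of each `x ∈ U` in exactly one
element `o x = x⁰`. -/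
structure InverseTransversalOn (mul : α → α → α) (U S0 : Set α) where
  sub : S0 ⊆ U
  mul_mem : ∀ a ∈ S0, ∀ b ∈ S0, mul a b ∈ S0
  o : α → α
  o_mem : ∀ x ∈ U, o x ∈ S0
  o_inv1 : ∀ x ∈ U, mul (mul x (o x)) x = x
  o_inv2 : ∀ x ∈ U, mul (mul (o x) x) (o x) = o x
  o_unique : ∀ x ∈ U, ∀ u ∈ S0, mul (mul x u) x = x → mul (mul u x) u = u → u = o x
  idem_comm : ∀ u ∈ S0, ∀ v ∈ S0, Idem mul u → Idem mul v → mul u v = mul v u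

namespace InverseTransversalOn

variable {mul : α → α → α} {U S0 : Set α}

/-- `L = {x ∈ U : x⁰x ∈ E⁰}`. -/
def LsetI (T : InverseTransversalOn mul U S0) : Set α :=
  {x | x ∈ U ∧ mul (T.o x) x ∈ S0 ∧ Idem mul (mul (T.o x) x)}

/-- `R = {x ∈ U : xx⁰ ∈ E⁰}`. -/
def RsetI (T : InverseTransversalOn mul U S0) : Set α :=
  {x | x ∈ U ∧ mul x (T.o x) ∈ S0 ∧ Idem mul (mul x (T.o x))}

end InverseTransversalOn

/-- Spined product set for an inverse transversal: `{(x,a) : x⁰ = a⁰}`. -/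
def invSpSet {mul : α → α → α} {U S0 : Set α}
    (T : InverseTransversalOn mul U S0) : Set (α × α) :=
  {p | p.1 ∈ T.LsetI ∧ p.2 ∈ T.RsetI ∧ T.o p.1 = T.o p.2}

/-- The multiplication `(x,a)(y,b) = ((xx⁰)(ay), (ay)(b⁰b))`. -/
def invSpMul {mul : α → α → α} {U S0 : Set α}
    (T : InverseTransversalOn mul U S0) : α × α → α × α → α × α :=
  fun p q => (mul (mul p.1 (T.o p.1)) (mul p.2 q.1),
              mul (mul p.2 q.1) (mul (T.o q.2) q.2))

/-- Abstract spined product for inverse transversals: `{(x,a) : x⁰ = a⁰}`. -/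
def invAbsTset {mulL : α → α → α} {mulR : β → β → β} {jL : γ → α} {jR : γ → β}
    (TL : InverseTransversalOn mulL Set.univ (Set.range jL))
    (TR : InverseTransversalOn mulR Set.univ (Set.range jR)) : Set (α × β) :=
  {p | ∃ s : γ, jL s = TL.o p.1 ∧ jR s = TR.o p.2}

/-- The multiplication `(x,a)(y,b) = ((xx⁰)(a∗y), (a∗y)(b⁰b))`. -/
def invAbsMul {mulL : α → α → α} {mulR : β → β → β} {jL : γ → α} {jR : γ → β}
    (TL : InverseTransversalOn mulL Set.univ (Set.range jL))
    (TR : InverseTransversalOn mulR Set.univ (Set.range jR))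
    (st : β → α → γ) : α × β → α × β → α × β :=
  fun p q => (mulL (mulL p.1 (TL.o p.1)) (jL (st p.2 q.1)),
              mulR (jR (st p.2 q.1)) (mulR (TR.o q.2) q.2))

/-- The multiplication `(e,x)(g,w) = (e(aa⁻¹), a)`, `a = x((x⁻¹x)g)w`, on `I × S⁰`
(Chen-style construction from a left normal band `I` with semilattice transversal
`E⁰ = E(S⁰)`; `σ` embeds idempotents of the inverse semigroup `γ` into the band
`β`, and `π : β → γ` is the semilattice-transversal map `e ↦ e⁰`). -/
def bandMul (mulB : β → β → β) (mulG : γ → γ → γ) (σ : γ → β) (π : β → γ)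
    (inv : γ → γ) (p q : β × γ) : β × γ :=
  let a := mulG (mulG p.2 (π (mulB (σ (mulG (inv p.2) p.2)) q.1))) q.2
  (mulB p.1 (σ (mulG a (inv a))), a)

/-- `T = {(e,x) : e⁰ = xx⁻¹}`. -/
def bandTset (mulG : γ → γ → γ) (π : β → γ) (inv : γ → γ) : Set (β × γ) :=
  {p | π p.1 = mulG p.2 (inv p.2)}

/-- `T⁰ = {(aa⁻¹, a) : a ∈ S⁰}` (with `aa⁻¹` viewed in the band via `σ`). -/
def bandT0 (mulG : γ → γ → γ) (σ : γ → β) (inv : γ → γ) : Set (β × γ) :=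
  {p | ∃ s : γ, p = (σ (mulG s (inv s)), s)}

end Paper

namespace Paper

section Semigroup

variable {S : Type*} [Semigroup S] {U S0 : Set S}

theorem rStarOn_of_mul_eq {a b : S} (hab : a * b = b) (hba : b * a = a) :
    RStarOn (mulOf S) U a b := by
  have key : ∀ x y : S, x * a = y * a ↔ x * b = y * b := fun x y =>
    ⟨fun h => by rw [← hab, ← mul_assoc, ← mul_assoc, h],
      fun h => by rw [← hba, ← mul_assoc, ← mul_assoc, h]⟩
  refine ⟨fun x _ y _ => key x y, fun x _ => ⟨fun h => ?_, fun h => ?_⟩⟩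
  · change x * a = a at h
    change x * b = b
    rw [← hab, ← mul_assoc, h]
  · change x * b = b at h
    change x * a = a
    rw [← hba, ← mul_assoc, h]

theorem lStarOn_of_mul_eq {a b : S} (hab : a * b = a) (hba : b * a = b) :
    LStarOn (mulOf S) U a b := by
  have key : ∀ x y : S, a * x = a * y ↔ b * x = b * y := fun x y =>
    ⟨fun h => by rw [← hba, mul_assoc, mul_assoc, h],
      fun h => by rw [← hab, mul_assoc, mul_assoc, h]⟩
  refine ⟨fun x _ y _ => key x y, fun x _ => ⟨fun h => ?_, fun h => ?_⟩⟩
  · change a * x = a at h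
    change b * x = b
    rw [← hba, mul_assoc, h]
  · change b * x = b at h
    change a * x = a
    rw [← hab, mul_assoc, h]

theorem GreenLOn.mul_eq {a b : S} (h : GreenLOn (mulOf S) U a b) (hb : Idem (mulOf S) b) :
    a * b = a := by
  change b * b = b at hb
  rcases h.1 with rfl | ⟨u, -, hu⟩
  · exact hb
  · change u * b = a at hu
    rw [← hu, mul_assoc, hb]

theorem GreenROn.mul_eq {a b : S} (h : GreenROn (mulOf S) U a b) (hb : Idem (mulOf S) b) :
    b * a = a := by
  change b * b = b at hb
  rcases h.1 with rfl | ⟨u, -, hu⟩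
  · exact hb
  · change b * u = a at hu
    rw [← hu, ← mul_assoc, hb]

theorem GreenLOn.symm {a b : S} (h : GreenLOn (mulOf S) U a b) : GreenLOn (mulOf S) U b a :=
  ⟨h.2, h.1⟩

theorem GreenROn.symm {a b : S} (h : GreenROn (mulOf S) U a b) : GreenROn (mulOf S) U b a :=
  ⟨h.2, h.1⟩

namespace AdequateTransversalOn

variable (T : AdequateTransversalOn (mulOf S) Set.univ S0)

theorem plus_mul {s : S} (hs : s ∈ S0) : T.plus s * s = s :=
  ((T.plus_rstar s hs).2 _ trivial).2 (T.plus_idem s hs)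

theorem mul_star {s : S} (hs : s ∈ S0) : s * T.star s = s :=
  ((T.star_lstar s hs).2 _ trivial).2 (T.star_idem s hs)

theorem plus_eq_self {s : S} (hs : s ∈ S0) (h : s * s = s) : T.plus s = s := by
  have h1 : s * T.plus s = T.plus s := ((T.plus_rstar s hs).2 s trivial).1 h
  have h2 : s * T.plus s = T.plus s * s :=
    T.idem_comm s hs _ (T.plus_mem s hs) h (T.plus_idem s hs)
  rw [← h1, h2, T.plus_mul hs]

theorem star_eq_self {s : S} (hs : s ∈ S0) (h : s * s = s) : T.star s = s := by
  have h1 : T.star s * s = T.star s := ((T.star_lstar s hs).2 s trivial).1 h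
  have h2 : s * T.star s = T.star s * s :=
    T.idem_comm s hs _ (T.star_mem s hs) h (T.star_idem s hs)
  rw [← h1, ← h2, T.mul_star hs]

theorem e_mul_plus (x : S) : T.e x * T.plus (T.bar x) = T.e x :=
  (T.e_greenL x trivial).mul_eq (T.plus_idem _ (T.bar_mem x trivial))

theorem plus_mul_e (x : S) : T.plus (T.bar x) * T.e x = T.plus (T.bar x) :=
  (T.e_greenL x trivial).symm.mul_eq (T.e_idem x trivial)

theorem star_mul_f (x : S) : T.star (T.bar x) * T.f x = T.f x :=
  (T.f_greenR x trivial).mul_eq (T.star_idem _ (T.bar_mem x trivial))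

theorem f_mul_star (x : S) : T.f x * T.star (T.bar x) = T.star (T.bar x) :=
  (T.f_greenR x trivial).symm.mul_eq (T.f_idem x trivial)

theorem f_eq_star (hS : LeftAdequateOn (mulOf S) Set.univ) (x : S) :
    T.f x = T.star (T.bar x) :=
  hS.2 _ trivial _ trivial (T.f_idem x trivial) (T.star_idem _ (T.bar_mem x trivial))
    (rStarOn_of_mul_eq (T.f_mul_star x) (T.star_mul_f x))

theorem e_eq_plus (hS : RightAdequateOn (mulOf S) Set.univ) (x : S) :
    T.e x = T.plus (T.bar x) :=
  hS.2 _ trivial _ trivial (T.e_idem x trivial) (T.plus_idem _ (T.bar_mem x trivial))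
    (lStarOn_of_mul_eq (T.e_mul_plus x) (T.plus_mul_e x))

theorem e_mul_bar (hS : LeftAdequateOn (mulOf S) Set.univ) (x : S) : T.e x * T.bar x = x := by
  have h : x = T.e x * T.bar x * T.f x := T.decomp x trivial
  rw [T.f_eq_star hS, mul_assoc, T.mul_star (T.bar_mem x trivial)] at h
  exact h.symm

theorem bar_mul_f (hS : RightAdequateOn (mulOf S) Set.univ) (x : S) : T.bar x * T.f x = x := by
  have h : x = T.e x * T.bar x * T.f x := T.decomp x trivial
  rw [T.e_eq_plus hS, T.plus_mul (T.bar_mem x trivial)] at h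
  exact h.symm

theorem data_mul {s e' f' : S} (hs : s ∈ S0) (he : e' * e' = e') (hf : f' * f' = f')
    (he1 : e' * T.plus s = e') (he2 : T.plus s * e' = T.plus s)
    (hf1 : T.star s * f' = f') (hf2 : f' * T.star s = T.star s) :
    s = T.bar (e' * s * f') ∧ e' = T.e (e' * s * f') ∧ f' = T.f (e' * s * f') :=
  T.unique _ trivial s hs e' trivial f' trivial he hf rfl
    ⟨.inr ⟨e', trivial, he1⟩, .inr ⟨_, trivial, he2⟩⟩
    ⟨.inr ⟨f', trivial, hf1⟩, .inr ⟨_, trivial, hf2⟩⟩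

theorem data_of_mem {s : S} (hs : s ∈ S0) :
    T.bar s = s ∧ T.e s = T.plus s ∧ T.f s = T.star s := by
  have hp := T.plus_idem s hs
  have hq := T.star_idem s hs
  obtain ⟨h1, h2, h3⟩ := T.data_mul hs hp hq hp hp hq hq
  rw [T.plus_mul hs, T.mul_star hs] at h1 h2 h3
  exact ⟨h1.symm, h2.symm, h3.symm⟩

theorem data_e (x : S) : T.bar (T.e x) = T.plus (T.bar x) ∧ T.e (T.e x) = T.e x := by
  have hb := T.bar_mem x trivial
  have hm := T.plus_mem _ hb
  have hp : T.plus (T.bar x) * T.plus (T.bar x) = T.plus (T.bar x) := T.plus_idem _ hb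
  have hpp := T.plus_eq_self hm hp
  have hps := T.star_eq_self hm hp
  obtain ⟨h1, h2, -⟩ := T.data_mul hm (T.e_idem x trivial) hp
    (by rw [hpp, T.e_mul_plus]) (by rw [hpp, T.plus_mul_e]) (by rw [hps, hp]) (by rw [hps, hp])
  rw [T.e_mul_plus, T.e_mul_plus] at h1 h2
  exact ⟨h1.symm, h2.symm⟩

theorem data_f (x : S) : T.bar (T.f x) = T.star (T.bar x) ∧ T.f (T.f x) = T.f x := by
  have hb := T.bar_mem x trivial
  have hm := T.star_mem _ hb
  have hq : T.star (T.bar x) * T.star (T.bar x) = T.star (T.bar x) := T.star_idem _ hb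
  have hqp := T.plus_eq_self hm hq
  have hqs := T.star_eq_self hm hq
  obtain ⟨h1, -, h3⟩ := T.data_mul hm hq (T.f_idem x trivial)
    (by rw [hqp, hq]) (by rw [hqp, hq]) (by rw [hqs, T.star_mul_f]) (by rw [hqs, T.f_mul_star])
  rw [hq, T.star_mul_f] at h1 h3
  exact ⟨h1.symm, h3.symm⟩

theorem mul_eq_mul_iff_plus {s : S} (hs : s ∈ S0) (u v : S) :
    u * s = v * s ↔ u * T.plus s = v * T.plus s :=
  (T.plus_rstar s hs).1 u trivial v trivial

theorem mul_eq_mul_iff_star {s : S} (hs : s ∈ S0) (u v : S) :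
    s * u = s * v ↔ T.star s * u = T.star s * v :=
  (T.star_lstar s hs).1 u trivial v trivial

end AdequateTransversalOn

end Semigroup

section Common

variable {L R G : Type*} [Semigroup L] [Semigroup R] [Semigroup G] {jL : G → L} {jR : G → R}

theorem exists_common_plus
    (hjL : Function.Injective jL) (hjR : Function.Injective jR)
    (hjLm : ∀ s t : G, jL (s * t) = jL s * jL t) (hjRm : ∀ s t : G, jR (s * t) = jR s * jR t)
    (TL : AdequateTransversalOn (mulOf L) Set.univ (Set.range jL))
    (TR : AdequateTransversalOn (mulOf R) Set.univ (Set.range jR)) (s : G) :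
    ∃ p : G, jL p = TL.plus (jL s) ∧ jR p = TR.plus (jR s) ∧ p * p = p ∧ p * s = s := by
  obtain ⟨p, hp⟩ := TL.plus_mem _ ⟨s, rfl⟩
  obtain ⟨p', hp'⟩ := TR.plus_mem _ ⟨s, rfl⟩
  have hpp : p * p = p := hjL <| by rw [hjLm, hp]; exact TL.plus_idem _ ⟨s, rfl⟩
  have hpp' : p' * p' = p' := hjR <| by rw [hjRm, hp']; exact TR.plus_idem _ ⟨s, rfl⟩
  have hps : p * s = s := hjL <| by rw [hjLm, hp, TL.plus_mul ⟨s, rfl⟩]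
  have hps' : p' * s = s := hjR <| by rw [hjRm, hp', TR.plus_mul ⟨s, rfl⟩]
  have h1 : p' * p = p := hjL <| by
    rw [hjLm, hp]
    exact ((TL.plus_rstar _ ⟨s, rfl⟩).2 _ trivial).1 ((hjLm _ _).symm.trans (by rw [hps']))
  have h2 : p * p' = p' := hjR <| by
    rw [hjRm, hp']
    exact ((TR.plus_rstar _ ⟨s, rfl⟩).2 _ trivial).1 ((hjRm _ _).symm.trans (by rw [hps]))
  have hc : p * p' = p' * p := hjL <| by
    rw [hjLm, hjLm]
    exact TL.idem_comm _ ⟨p, rfl⟩ _ ⟨p', rfl⟩ ((hjLm _ _).symm.trans (by rw [hpp]))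
      ((hjLm _ _).symm.trans (by rw [hpp']))
  have : p = p' := by rw [← h1, ← hc, h2]
  subst this
  exact ⟨p, hp, hp', hpp, hps⟩

theorem exists_common_star
    (hjL : Function.Injective jL) (hjR : Function.Injective jR)
    (hjLm : ∀ s t : G, jL (s * t) = jL s * jL t) (hjRm : ∀ s t : G, jR (s * t) = jR s * jR t)
    (TL : AdequateTransversalOn (mulOf L) Set.univ (Set.range jL))
    (TR : AdequateTransversalOn (mulOf R) Set.univ (Set.range jR)) (s : G) :
    ∃ q : G, jL q = TL.star (jL s) ∧ jR q = TR.star (jR s) ∧ q * q = q ∧ s * q = s := by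
  obtain ⟨q, hq⟩ := TL.star_mem _ ⟨s, rfl⟩
  obtain ⟨q', hq'⟩ := TR.star_mem _ ⟨s, rfl⟩
  have hqq : q * q = q := hjL <| by rw [hjLm, hq]; exact TL.star_idem _ ⟨s, rfl⟩
  have hqq' : q' * q' = q' := hjR <| by rw [hjRm, hq']; exact TR.star_idem _ ⟨s, rfl⟩
  have hsq : s * q = s := hjL <| by rw [hjLm, hq, TL.mul_star ⟨s, rfl⟩]
  have hsq' : s * q' = s := hjR <| by rw [hjRm, hq', TR.mul_star ⟨s, rfl⟩]
  have h1 : q * q' = q := hjL <| by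
    rw [hjLm, hq]
    exact ((TL.star_lstar _ ⟨s, rfl⟩).2 _ trivial).1 ((hjLm _ _).symm.trans (by rw [hsq']))
  have h2 : q' * q = q' := hjR <| by
    rw [hjRm, hq']
    exact ((TR.star_lstar _ ⟨s, rfl⟩).2 _ trivial).1 ((hjRm _ _).symm.trans (by rw [hsq]))
  have hc : q * q' = q' * q := hjL <| by
    rw [hjLm, hjLm]
    exact TL.idem_comm _ ⟨q, rfl⟩ _ ⟨q', rfl⟩ ((hjLm _ _).symm.trans (by rw [hqq]))
      ((hjLm _ _).symm.trans (by rw [hqq']))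
  have : q = q' := by rw [← h1, hc, h2]
  subst this
  exact ⟨q, hq, hq', hqq, hsq⟩

end Common

end Paper

open Paper in
/-- For every `(x,a) ∈ T`, the pairs `(e_x, e_{x̄})` and
`(f_{ā}, f_a)` are idempotents of `T` with `(x,a) ℛ* (e_x, e_{x̄})` and
`(x,a) ℒ* (f_{ā}, f_a)` in `T`; consequently `T` is abundant.  (Here `s : G`
with `jL s = x̄`, `jR s = ā` represents the common transversal element, so
`e_{x̄} = TR.e (jR s)` in `R` and `f_{ā} = TL.f (jL s)` in `L`.) -/
theorem stmt14 {L R G : Type u} [Semigroup L] [Semigroup R] [Semigroup G]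
    (jL : G → L) (jR : G → R)
    (hjL : Function.Injective jL) (hjR : Function.Injective jR)
    (hjLm : ∀ s t : G, jL (s * t) = jL s * jL t)
    (hjRm : ∀ s t : G, jR (s * t) = jR s * jR t)
    (hG : AdequateOn (mulOf G) Set.univ)
    (hL : LeftAdequateOn (mulOf L) Set.univ)
    (hR : RightAdequateOn (mulOf R) Set.univ)
    (TL : AdequateTransversalOn (mulOf L) Set.univ (Set.range jL))
    (TR : AdequateTransversalOn (mulOf R) Set.univ (Set.range jR))
    (hQL : QuasiIdealOn (mulOf L) Set.univ (Set.range jL))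
    (hQR : QuasiIdealOn (mulOf R) Set.univ (Set.range jR))
    (st : R → L → G)
    (cond1 : ∀ (y z : L) (a b : R),
      (∃ s : G, jL s = TL.bar y ∧ jR s = TR.bar b) →
      st (jR (st a y) * TR.f b) z = st a (TL.e y * jL (st b z)))
    (cond2L : ∀ (s : G) (x : L), jL (st (jR s) x) = jL s * x)
    (cond2R : ∀ (a : R) (s : G), jR (st a (jL s)) = a * jR s)
    :
    (∀ p ∈ absTset TL TR, ∀ s : G, jL s = TL.bar p.1 → jR s = TR.bar p.2 →
      (TL.e p.1, TR.e (jR s)) ∈ absTset TL TR ∧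
      Idem (absMul TL TR st) (TL.e p.1, TR.e (jR s)) ∧
      (TL.f (jL s), TR.f p.2) ∈ absTset TL TR ∧
      Idem (absMul TL TR st) (TL.f (jL s), TR.f p.2) ∧
      RStarOn (absMul TL TR st) (absTset TL TR) p (TL.e p.1, TR.e (jR s)) ∧
      LStarOn (absMul TL TR st) (absTset TL TR) p (TL.f (jL s), TR.f p.2)) ∧
    AbundantOn (absMul TL TR st) (absTset TL TR) := by
  have main : ∀ p ∈ absTset TL TR, ∀ s : G, jL s = TL.bar p.1 → jR s = TR.bar p.2 →
      (TL.e p.1, TR.e (jR s)) ∈ absTset TL TR ∧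
      Idem (absMul TL TR st) (TL.e p.1, TR.e (jR s)) ∧
      (TL.f (jL s), TR.f p.2) ∈ absTset TL TR ∧
      Idem (absMul TL TR st) (TL.f (jL s), TR.f p.2) ∧
      RStarOn (absMul TL TR st) (absTset TL TR) p (TL.e p.1, TR.e (jR s)) ∧
      LStarOn (absMul TL TR st) (absTset TL TR) p (TL.f (jL s), TR.f p.2) := by
    rintro ⟨x, a⟩ - s hs hs'
    dsimp only at hs hs'
    obtain ⟨p, hpL, hpR, hpp, hps⟩ := exists_common_plus hjL hjR hjLm hjRm TL TR s
    obtain ⟨q, hqL, hqR, hqq, hsq⟩ := exists_common_star hjL hjR hjLm hjRm TL TR s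
    -- the data attached to `x` in `L`
    have hex : TL.e x * jL s = x := by rw [hs, TL.e_mul_bar hL]
    have hep : TL.e x * jL p = TL.e x := by rw [hpL, hs, TL.e_mul_plus]
    have hpe : jL p * TL.e x = jL p := by rw [hpL, hs, TL.plus_mul_e]
    have hbe : TL.bar (TL.e x) = jL p := by rw [(TL.data_e x).1, hpL, hs]
    have hee : TL.e (TL.e x) = TL.e x := (TL.data_e x).2
    have hfsL : TL.f (jL s) = jL q := by rw [(TL.data_of_mem ⟨s, rfl⟩).2.2, hqL]
    have hbqL : TL.bar (jL q) = jL q := (TL.data_of_mem ⟨q, rfl⟩).1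
    have heqL : TL.e (jL q) = jL q := by
      rw [(TL.data_of_mem ⟨q, rfl⟩).2.1, TL.plus_eq_self ⟨q, rfl⟩ (by rw [← hjLm, hqq])]
    -- the data attached to `a` in `R`
    have haf : jR s * TR.f a = a := by rw [hs', TR.bar_mul_f hR]
    have hfq : TR.f a * jR q = jR q := by rw [hqR, hs', TR.f_mul_star]
    have hqf : jR q * TR.f a = TR.f a := by rw [hqR, hs', TR.star_mul_f]
    have hbf : TR.bar (TR.f a) = jR q := by rw [(TR.data_f a).1, hqR, hs']
    have hff : TR.f (TR.f a) = TR.f a := (TR.data_f a).2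
    have hesR : TR.e (jR s) = jR p := by rw [(TR.data_of_mem ⟨s, rfl⟩).2.1, hpR]
    have hbpR : TR.bar (jR p) = jR p := (TR.data_of_mem ⟨p, rfl⟩).1
    have hfpR : TR.f (jR p) = jR p := by
      rw [(TR.data_of_mem ⟨p, rfl⟩).2.2, TR.star_eq_self ⟨p, rfl⟩ (by rw [← hjRm, hpp])]
    have st_e_mul : ∀ (b : R) (t : G), p * t = t →
        st b (TL.e x * jL t) = st b (TL.e x) * t := fun b t ht => by
      have h := cond1 (TL.e x) (jL t) b (jR p) ⟨p, hbe.symm, hbpR.symm⟩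
      have h2 : st (jR p) (jL t) = t := hjR <| by rw [cond2R, ← hjRm, ht]
      rw [hfpR, hee, h2] at h
      rw [← h]
      apply hjR
      rw [cond2R, mul_assoc, ← hjRm, ht, hjRm]
    have st_mul_f : ∀ (y : L) (t : G), t * q = t →
        st (jR t * TR.f a) y = t * st (TR.f a) y := fun y t ht => by
      have h := cond1 (jL q) y (jR t) (TR.f a) ⟨q, hbqL.symm, hbf.symm⟩
      have h2 : st (jR t) (jL q) = t := hjR <| by rw [cond2R, ← hjRm, ht]
      rw [hff, heqL, h2] at h
      rw [h]
      apply hjL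
      rw [cond2L, ← mul_assoc, ← hjLm, ht, hjLm]
    have hst_x : ∀ b : R, st b x = st b (TL.e x) * s := fun b => by
      rw [← st_e_mul b s hps, hex]
    have hst_e : ∀ b : R, st b (TL.e x) * p = st b (TL.e x) := fun b => by
      rw [← st_e_mul b p hpp, hep]
    have hst_a : ∀ y : L, st a y = s * st (TR.f a) y := fun y => by
      rw [← st_mul_f y s hsq, haf]
    have hst_f : ∀ y : L, q * st (TR.f a) y = st (TR.f a) y := fun y => by
      rw [← st_mul_f y q hqq, hqf]
    -- the two cancellation laws behind the `ℛ*` and `ℒ*` claims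
    have cancelR : ∀ (u v : L) (c d : R),
        ((u * jL s, c * a) : L × R) = (v * jL s, d * a) ↔
          ((u * jL p, c * jR p) : L × R) = (v * jL p, d * jR p) := fun u v c d => by
      have ha : c * a = d * a ↔ c * jR s = d * jR s := by
        refine ⟨fun h => ?_, fun h => by rw [← haf, ← mul_assoc, h, mul_assoc]⟩
        have haq : a * jR q = jR s := by
          rw [← haf, mul_assoc, hfq, ← hjRm, hsq]
        rw [← haq, ← mul_assoc, h, mul_assoc]
      rw [Prod.mk.injEq, Prod.mk.injEq, ha, TL.mul_eq_mul_iff_plus ⟨s, rfl⟩,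
        TR.mul_eq_mul_iff_plus ⟨s, rfl⟩, hpL, hpR]
    have cancelL : ∀ (u v : L) (c d : R),
        ((x * u, jR s * c) : L × R) = (x * v, jR s * d) ↔
          ((jL q * u, jR q * c) : L × R) = (jL q * v, jR q * d) := fun u v c d => by
      have hx : x * u = x * v ↔ jL s * u = jL s * v := by
        refine ⟨fun h => ?_, fun h => by rw [← hex, mul_assoc, h, mul_assoc]⟩
        have hpx : jL p * x = jL s := by
          rw [← hex, ← mul_assoc, hpe, ← hjLm, hps]
        rw [← hpx, mul_assoc, h, mul_assoc]
      rw [Prod.mk.injEq, Prod.mk.injEq, hx, TL.mul_eq_mul_iff_star ⟨s, rfl⟩,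
        TR.mul_eq_mul_iff_star ⟨s, rfl⟩, hqL, hqR]
    have mul_p : ∀ w : L × R, absMul TL TR st w (x, a) =
        (TL.e w.1 * jL (st w.2 (TL.e x)) * jL s, jR (st w.2 (TL.e x)) * a) := fun w => by
      change (TL.e w.1 * jL (st w.2 x), jR (st w.2 x) * TR.f a) = _
      rw [hst_x, hjLm, hjRm, mul_assoc (jR _), haf, mul_assoc]
    have mul_plus : ∀ w : L × R, absMul TL TR st w (TL.e x, jR p) =
        (TL.e w.1 * jL (st w.2 (TL.e x)) * jL p, jR (st w.2 (TL.e x)) * jR p) := fun w => by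
      change (TL.e w.1 * jL (st w.2 (TL.e x)), jR (st w.2 (TL.e x)) * TR.f (jR p)) = _
      rw [hfpR, mul_assoc, ← hjLm, hst_e]
    have p_mul : ∀ w : L × R, absMul TL TR st (x, a) w =
        (x * jL (st (TR.f a) w.1), jR s * (jR (st (TR.f a) w.1) * TR.f w.2)) := fun w => by
      change (TL.e x * jL (st a w.1), jR (st a w.1) * TR.f w.2) = _
      rw [hst_a, hjLm, hjRm, ← mul_assoc, hex, mul_assoc]
    have star_mul : ∀ w : L × R, absMul TL TR st (jL q, TR.f a) w =
        (jL q * jL (st (TR.f a) w.1), jR q * (jR (st (TR.f a) w.1) * TR.f w.2)) := fun w => by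
      change (TL.e (jL q) * jL (st (TR.f a) w.1), jR (st (TR.f a) w.1) * TR.f w.2) = _
      rw [heqL, ← mul_assoc, ← hjRm, hst_f]
    have p_eq_right : ((x, a) : L × R) = (TL.e x * jL s, jR p * a) := by
      rw [hex, ← haf, ← mul_assoc, ← hjRm, hps]
    have plus_eq : ((TL.e x, jR p) : L × R) = (TL.e x * jL p, jR p * jR p) := by
      rw [hep, ← hjRm, hpp]
    have p_eq_left : ((x, a) : L × R) = (x * jL q, jR s * TR.f a) := by
      rw [haf, ← hex, mul_assoc, ← hjLm, hsq]
    have star_eq : ((jL q, TR.f a) : L × R) = (jL q * jL q, jR q * TR.f a) := by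
      rw [hqf, ← hjLm, hqq]
    dsimp only
    rw [hesR, hfsL]
    refine ⟨⟨p, hbe.symm, hbpR.symm⟩, ?_, ⟨q, hbqL.symm, hbf.symm⟩, ?_, ⟨?_, ?_⟩, ⟨?_, ?_⟩⟩
    · have h : st (jR p) (TL.e x) = p := hjL <| by rw [cond2L, hpe]
      change absMul TL TR st _ _ = _
      rw [mul_plus]
      dsimp only
      rw [hee, h, hep, hep, ← hjRm, hpp]
    · have h : st (TR.f a) (jL q) = q := hjR <| by rw [cond2R, hfq]
      change absMul TL TR st _ _ = _
      rw [star_mul]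
      dsimp only
      rw [hff, h, hqf, hqf, ← hjLm, hqq]
    · intro w _ z _
      rw [mul_p, mul_p, mul_plus, mul_plus]
      exact cancelR _ _ _ _
    · intro w _
      rw [mul_p, mul_plus]
      have h := cancelR (TL.e w.1 * jL (st w.2 (TL.e x))) (TL.e x) (jR (st w.2 (TL.e x))) (jR p)
      rwa [← p_eq_right, ← plus_eq] at h
    · intro w _ z _
      rw [p_mul, p_mul, star_mul, star_mul]
      exact cancelL _ _ _ _
    · intro w _
      rw [p_mul, star_mul]
      have h := cancelL (jL (st (TR.f a) w.1)) (jL q) (jR (st (TR.f a) w.1) * TR.f w.2) (TR.f a)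
      rwa [← p_eq_left, ← star_eq] at h
  refine ⟨main, fun p hp => ?_⟩
  obtain ⟨s, hs, hs'⟩ := hp
  obtain ⟨h1, h2, h3, h4, h5, h6⟩ := main p ⟨s, hs, hs'⟩ s hs hs'
  exact ⟨⟨_, h1, h2, h5⟩, ⟨_, h3, h4, h6⟩⟩
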